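/- arXiv:1902.00180 — 4 statements merged into one kernel-verified Lean document; each statement's English description precedes it below -/
import Mathlib

section
/- Let Q be an irreducible row-stochastic matrix on a finite set N and let π be a positive probability vector on N. For each j ∈ N let S_j := {i ∈ N : Q_{ij} > 0}, assume S_j is nonempty for every j, and let (α_{ij})_{i∈S_j} be real numbers with α_{ij} > 0 for i ∈ S_j, α_{ij} = 0 for i ∉ S_j, and ∑_{i∈S_j} α_{ij} = 1. Let c > 0 be such that γ_{ij} := (π(j) α_{ij}) / (c π(i) Q_{ij}) ≤ 1 for every pair (i,j) with Q_{ij} > 0 (and γ_{ij} := 0 when Q_{ij} = 0), and set P̃_{ij} = Q_{ij} γ_{ij}. Then P̃ is an irreducible substochastic matrix, and π is the unique probability vector that is a left eigenvector of P̃ corresponding to a positive eigenvalue: if ν is any probability vector on N and κ > 0 satisfies ∑_{i} ν(i) P̃_{ij} = κ ν(j) for all j, then ν = π and κ = 1/c. -/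
theorem aux_pow_nonneg {N : Type*} [Fintype N] [DecidableEq N] (Q : Matrix N N ℝ)
    (h : ∀ i j, 0 ≤ Q i j) (k : ℕ) : ∀ i j, 0 ≤ (Q ^ k) i j := by
  induction k with
  | zero =>
    intro i j
    rw [pow_zero, Matrix.one_apply]
    split_ifs <;> norm_num
  | succ k ih =>
    intro i j
    rw [pow_succ, Matrix.mul_apply]
    exact Finset.sum_nonneg fun l _ => mul_nonneg (ih i l) (h l j)

theorem aux_pow_succ {N : Type*} [Fintype N] [DecidableEq N] (Q : Matrix N N ℝ)
    (h : ∀ i j, 0 ≤ Q i j) (k : ℕ) (i j : N) (hp : 0 < (Q ^ (k + 1)) i j) :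
    ∃ l, 0 < (Q ^ k) i l ∧ 0 < Q l j := by
  rw [pow_succ, Matrix.mul_apply] at hp
  by_contra! hcon
  refine absurd hp (not_lt.mpr (Finset.sum_nonpos fun l _ => ?_))
  rcases (aux_pow_nonneg Q h k i l).eq_or_lt with h0 | h0
  · rw [← h0, zero_mul]
  · exact mul_nonpos_of_nonneg_of_nonpos h0.le (hcon l h0)

theorem aux_pow_pos {N : Type*} [Fintype N] [DecidableEq N] (Q P : Matrix N N ℝ)
    (h : ∀ i j, 0 ≤ Q i j) (h' : ∀ i j, 0 ≤ P i j) (hQP : ∀ i j, 0 < Q i j → 0 < P i j)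
    (k : ℕ) : ∀ i j, 0 < (Q ^ k) i j → 0 < (P ^ k) i j := by
  induction k with
  | zero => intro i j hp; simpa using hp
  | succ k ih =>
    intro i j hp
    obtain ⟨l, h1, h2⟩ := aux_pow_succ Q h k i j hp
    rw [pow_succ, Matrix.mul_apply]
    exact Finset.sum_pos' (fun l _ => mul_nonneg (aux_pow_nonneg P h' k i l) (h' l j))
      ⟨l, Finset.mem_univ _, mul_pos (ih _ _ h1) (hQP _ _ h2)⟩

theorem aux_closed {N : Type*} [Fintype N] [DecidableEq N] (Q : Matrix N N ℝ)
    (h : ∀ i j, 0 ≤ Q i j) (hirr : ∀ i j, ∃ k ≥ 1, 0 < (Q ^ k) i j)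
    (S : N → Prop) (hS : ∀ i j, 0 < Q i j → S j → S i) (j : N) (hj : S j) (i : N) : S i := by
  have key : ∀ k : ℕ, ∀ j, 0 < (Q ^ k) i j → S j → S i := by
    intro k
    induction k with
    | zero =>
      intro j hp hj
      rw [pow_zero, Matrix.one_apply] at hp
      split_ifs at hp with e
      · exact e ▸ hj
      · exact absurd hp (lt_irrefl _)
    | succ k ih =>
      intro j hp hj
      obtain ⟨l, h1, h2⟩ := aux_pow_succ Q h k i j hp
      exact ih l h1 (hS l j h2 hj)
  obtain ⟨k, _, hk⟩ := hirr i j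
  exact key k j hk hj

/-- The matrix `P̃ i j = Q i j * γ i j` built from the NMMC acceptance
probabilities is an irreducible substochastic matrix, and `π` is the unique probability
vector that is a left eigenvector of `P̃` with a positive eigenvalue; the eigenvalue is `1/c`. -/
theorem nmmc_mapping_unique
    {N : Type*} [Fintype N] [Nonempty N] [DecidableEq N]
    (Q : Matrix N N ℝ)
    (hQnn : ∀ i j, 0 ≤ Q i j)
    (hQrow : ∀ i, ∑ j, Q i j = 1)
    (hQirr : ∀ i j, ∃ k ≥ 1, 0 < (Q ^ k) i j)
    (π : N → ℝ) (hπpos : ∀ i, 0 < π i) (hπsum : ∑ i, π i = 1)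
    (α : N → N → ℝ)
    (hSne : ∀ j, ∃ i, 0 < Q i j)
    (hαpos : ∀ i j, 0 < Q i j → 0 < α i j)
    (hαzero : ∀ i j, Q i j = 0 → α i j = 0)
    (hαsum : ∀ j, ∑ i, α i j = 1)
    (c : ℝ) (hc : 0 < c)
    (γ : N → N → ℝ)
    (hγ : ∀ i j, 0 < Q i j → γ i j = (π j * α i j) / (c * π i * Q i j))
    (hγ0 : ∀ i j, Q i j = 0 → γ i j = 0)
    (hγle : ∀ i j, 0 < Q i j → γ i j ≤ 1)
    (P : Matrix N N ℝ)
    (hP : ∀ i j, P i j = Q i j * γ i j) :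
    (∀ i j, 0 ≤ P i j) ∧
    (∀ i, ∑ j, P i j ≤ 1) ∧
    (∀ i j, ∃ k ≥ 1, 0 < (P ^ k) i j) ∧
    (∀ (ν : N → ℝ) (κ : ℝ),
      (∀ i, 0 ≤ ν i) → (∑ i, ν i = 1) → 0 < κ →
      (∀ j, ∑ i, ν i * P i j = κ * ν j) →
      ν = π ∧ κ = 1 / c) := by
  have hPf : ∀ i j, P i j = π j * α i j / (c * π i) := by
    intro i j
    have := (hπpos i).ne'
    rw [hP]
    rcases (hQnn i j).eq_or_lt with h | h
    · rw [hαzero i j h.symm, ← h]; simp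
    · have := h.ne'
      rw [hγ i j h]; field_simp
  have hα0 : ∀ i j, 0 ≤ α i j := by
    intro i j
    rcases (hQnn i j).eq_or_lt with h | h
    · rw [hαzero i j h.symm]
    · exact (hαpos i j h).le
  have hP0 : ∀ i j, 0 ≤ P i j := by
    intro i j
    rw [hPf]
    exact div_nonneg (mul_nonneg (hπpos j).le (hα0 i j)) (mul_pos hc (hπpos i)).le
  refine ⟨hP0, ?_, ?_, ?_⟩
  · intro i
    rw [← hQrow i]
    refine Finset.sum_le_sum fun j _ => ?_
    rw [hP]
    rcases (hQnn i j).eq_or_lt with h | h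
    · rw [← h]; simp
    · exact mul_le_of_le_one_right h.le (hγle i j h)
  · intro i j
    obtain ⟨k, hk, hp⟩ := hQirr i j
    refine ⟨k, hk, aux_pow_pos Q P hQnn hP0 ?_ k i j hp⟩
    intro i j h
    rw [hPf]
    exact div_pos (mul_pos (hπpos j) (hαpos i j h)) (mul_pos hc (hπpos i))
  · intro ν κ hν hνs hκ hev
    obtain ⟨f, hf⟩ : ∃ f : N → ℝ, ∀ i, ν i = f i * π i :=
      ⟨fun i => ν i / π i, fun i => (div_mul_cancel₀ _ (hπpos i).ne').symm⟩
    have hf0 : ∀ i, 0 ≤ f i := fun i => by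
      have := hν i
      rw [hf] at this
      exact nonneg_of_mul_nonneg_left this (hπpos i)
    have hfe : ∀ j, ∑ i, α i j * f i = c * κ * f j := by
      intro j
      have h1 := hev j
      have h2 : ∑ i, ν i * P i j = (π j / c) * ∑ i, α i j * f i := by
        rw [Finset.mul_sum]
        refine Finset.sum_congr rfl fun i _ => ?_
        have := (hπpos i).ne'
        rw [hPf, hf]; field_simp
      rw [h2, hf] at h1
      have := (hπpos j).ne'
      field_simp at h1
      linarith
    have hfpos : ∀ i, 0 < f i := by
      intro j
      refine (hf0 j).lt_of_ne' fun hj => ?_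
      have hz := aux_closed Q hQnn hQirr (fun i => f i = 0) (by
        intro i j hq hj
        have h1 := hfe j
        rw [hj, mul_zero, Finset.sum_eq_zero_iff_of_nonneg
          (fun i _ => mul_nonneg (hα0 i j) (hf0 i))] at h1
        exact (mul_eq_zero.mp (h1 i (Finset.mem_univ _))).resolve_left (hαpos i j hq).ne') j hj
      simp [hf, hz] at hνs
    obtain ⟨a, ha⟩ := Finite.exists_max f
    obtain ⟨b, hb⟩ := Finite.exists_min f
    have e1 : c * κ ≤ 1 := by
      have : c * κ * f a ≤ 1 * f a := by
        rw [← hfe a, ← hαsum a, Finset.sum_mul]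
        exact Finset.sum_le_sum fun i _ => mul_le_mul_of_nonneg_left (ha i) (hα0 i a)
      exact le_of_mul_le_mul_right this (hfpos a)
    have e2 : 1 ≤ c * κ := by
      have : 1 * f b ≤ c * κ * f b := by
        rw [← hfe b, ← hαsum b, Finset.sum_mul]
        exact Finset.sum_le_sum fun i _ => mul_le_mul_of_nonneg_left (hb i) (hα0 i b)
      exact le_of_mul_le_mul_right this (hfpos b)
    have e : c * κ = 1 := le_antisymm e1 e2
    have hconst : ∀ i, f i = f a := aux_closed Q hQnn hQirr (fun i => f i = f a) (by
      intro i j hq hj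
      have h1 : ∑ i, α i j * (f a - f i) = 0 := by
        simp only [mul_sub, Finset.sum_sub_distrib]
        rw [hfe j, ← Finset.sum_mul, hαsum, e, hj, sub_self]
      rw [Finset.sum_eq_zero_iff_of_nonneg
          (fun i _ => mul_nonneg (hα0 i j) (sub_nonneg.mpr (ha i)))] at h1
      have := (mul_eq_zero.mp (h1 i (Finset.mem_univ _))).resolve_left (hαpos i j hq).ne'
      linarith) a rfl
    have hM : f a = 1 := by
      have : ∑ i, ν i = f a * ∑ i, π i := by
        rw [Finset.mul_sum]
        exact Finset.sum_congr rfl fun i _ => by rw [hf, hconst]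
      rw [hνs, hπsum] at this
      linarith
    refine ⟨funext fun i => by rw [hf, hconst, hM, one_mul], ?_⟩
    rw [eq_div_iff hc.ne']
    linarith
end

section
/- Let P̃ be a substochastic matrix on a finite set N, and for each i ∈ N set p_i := 1 − ∑_{j∈N} P̃_{ij} (the one-step absorption probability from i). Let ν be a probability vector on N and define the matrix P^ν by P^ν_{ij} := P̃_{ij} + p_i ν(j). Then P^ν is row-stochastic, and ν is a stationary distribution of P^ν (i.e., ∑_i ν(i) P^ν_{ij} = ν(j) for all j) if and only if ∑_i ν(i) P̃_{ij} = λ ν(j) for all j, where λ := 1 − ∑_{i∈N} ν(i) p_i. -/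
/-- Fixed-point characterization of the QSD.  With absorption
probabilities `p i = 1 - ∑ j, P̃ i j`, the redistribution matrix
`P^ν i j = P̃ i j + p i * ν j` is row-stochastic, and `ν` is stationary for `P^ν`
iff `ν P̃ = λ ν` with `λ = 1 - ∑ i, ν i * p i`. -/
theorem qsd_fixed_point_characterization
    {N : Type*} [Fintype N] [Nonempty N]
    (P : Matrix N N ℝ)
    (hPnn : ∀ i j, 0 ≤ P i j)
    (hProw : ∀ i, ∑ j, P i j ≤ 1)
    (ν : N → ℝ) (hνnn : ∀ i, 0 ≤ ν i) (hνsum : ∑ i, ν i = 1) :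
    (∀ i j, 0 ≤ P i j + (1 - ∑ k, P i k) * ν j) ∧
    (∀ i, ∑ j, (P i j + (1 - ∑ k, P i k) * ν j) = 1) ∧
    ((∀ j, ∑ i, ν i * (P i j + (1 - ∑ k, P i k) * ν j) = ν j) ↔
      (∀ j, ∑ i, ν i * P i j = (1 - ∑ i, ν i * (1 - ∑ k, P i k)) * ν j)) := by
  refine ⟨fun i j => add_nonneg (hPnn i j)
    (mul_nonneg (sub_nonneg.2 (hProw i)) (hνnn j)), fun i => ?_, forall_congr' fun j => ?_⟩
  · rw [Finset.sum_add_distrib, ← Finset.mul_sum, hνsum]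
    ring
  · have h : ∑ i, ν i * (P i j + (1 - ∑ k, P i k) * ν j)
        = ∑ i, ν i * P i j + (∑ i, ν i * (1 - ∑ k, P i k)) * ν j := by
      rw [Finset.sum_mul, ← Finset.sum_add_distrib]
      exact Finset.sum_congr rfl fun i _ => by ring
    rw [h]
    constructor <;> intro h <;> linarith
end

section
/- Let A be an irreducible matrix on a finite set N with entries in {0,1}; write d_i^+ := ∑_j A_{ij} and d_j^- := ∑_i A_{ij} (so d_i^+ ≥ 1 and d_j^- ≥ 1 for all nodes by irreducibility). Let π be a positive probability vector on N and let c > 0 satisfy (π(j)/π(i)) · (d_i^+/d_j^-) ≤ c for every pair (i,j) with A_{ij} = 1. Define P̃_{ij} := A_{ij} · π(j) / (c · π(i) · d_j^-). Then P̃ is substochastic, P̃_{ij} equals Q_{ij} γ_{ij} where Q_{ij} = A_{ij}/d_i^+ is the simple-random-walk proposal and γ_{ij} = (π(j)/π(i)) · (d_i^+/d_j^-) / c ≤ 1 is the acceptance probability, and ∑_{i∈N} π(i) P̃_{ij} = (1/c) π(j) for every j ∈ N. -/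
/-- With the simple-random-walk proposal `Q i j = A i j / d⁺ i` and
acceptance probability `γ i j = (π j / π i) * (d⁺ i / d⁻ j) / c`, the matrix
`P̃ i j = A i j * π j / (c * π i * d⁻ j)` is substochastic, factors as `Q i j * γ i j`
with `γ i j ≤ 1` on edges, and satisfies `π P̃ = (1/c) π`. -/
theorem nmmc_srw_mapping
    {N : Type*} [Fintype N] [Nonempty N] [DecidableEq N]
    (A : Matrix N N ℝ)
    (hA01 : ∀ i j, A i j = 0 ∨ A i j = 1)
    (hAirr : ∀ i j, ∃ k ≥ 1, 0 < (A ^ k) i j)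
    (dout din : N → ℝ)
    (hdout : ∀ i, dout i = ∑ j, A i j)
    (hdin : ∀ j, din j = ∑ i, A i j)
    (π : N → ℝ) (hπpos : ∀ i, 0 < π i) (hπsum : ∑ i, π i = 1)
    (c : ℝ) (hc : 0 < c)
    (hcge : ∀ i j, A i j = 1 → (π j / π i) * (dout i / din j) ≤ c) :
    (∀ i j, 0 ≤ A i j * π j / (c * π i * din j)) ∧
    (∀ i, ∑ j, A i j * π j / (c * π i * din j) ≤ 1) ∧
    (∀ i j, A i j * π j / (c * π i * din j)
      = (A i j / dout i) * ((π j / π i) * (dout i / din j) / c)) ∧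
    (∀ i j, A i j = 1 → (π j / π i) * (dout i / din j) / c ≤ 1) ∧
    (∀ j, ∑ i, π i * (A i j * π j / (c * π i * din j)) = (1 / c) * π j) := by
  have hA0 : ∀ i j, 0 ≤ A i j := fun i j => by
    rcases hA01 i j with h | h <;> rw [h] <;> norm_num
  have hdo : ∀ i, 0 < dout i := by
    intro i
    rw [hdout]
    refine lt_of_le_of_ne (Finset.sum_nonneg fun j _ => hA0 i j) fun h => ?_
    have hz := (Finset.sum_eq_zero_iff_of_nonneg (fun j _ => hA0 i j)).1 h.symm
    obtain ⟨k, hk, hp⟩ := hAirr i i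
    obtain ⟨m, rfl⟩ := Nat.exists_eq_add_of_le' hk
    rw [pow_succ', Matrix.mul_apply] at hp
    refine hp.ne' (Finset.sum_eq_zero fun j hj => ?_)
    rw [hz j hj, zero_mul]
  have hdi : ∀ i, 0 < din i := by
    intro i
    rw [hdin]
    refine lt_of_le_of_ne (Finset.sum_nonneg fun j _ => hA0 j i) fun h => ?_
    have hz := (Finset.sum_eq_zero_iff_of_nonneg (fun j _ => hA0 j i)).1 h.symm
    obtain ⟨k, hk, hp⟩ := hAirr i i
    obtain ⟨m, rfl⟩ := Nat.exists_eq_add_of_le' hk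
    rw [pow_succ, Matrix.mul_apply] at hp
    refine hp.ne' (Finset.sum_eq_zero fun j hj => ?_)
    rw [hz j hj, mul_zero]
  have hfac : ∀ i j, A i j * π j / (c * π i * din j)
      = (A i j / dout i) * ((π j / π i) * (dout i / din j) / c) := by
    intro i j
    have h1 := (hdo i).ne'
    have h2 := (hdi j).ne'
    have h3 := (hπpos i).ne'
    have h4 := hc.ne'
    field_simp
  have hacc : ∀ i j, A i j = 1 → (π j / π i) * (dout i / din j) / c ≤ 1 := by
    intro i j h
    rw [div_le_one hc]
    exact hcge i j h
  refine ⟨fun i j => ?_, fun i => ?_, hfac, hacc, fun j => ?_⟩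
  · have h1 := hA0 i j
    have h2 := hdi j
    have h3 := hπpos i
    have h4 := hπpos j
    positivity
  · calc ∑ j, A i j * π j / (c * π i * din j) ≤ ∑ j, A i j / dout i := by
          refine Finset.sum_le_sum fun j _ => ?_
          rw [hfac]
          rcases hA01 i j with h | h
          · simp [h]
          · exact mul_le_of_le_one_right (div_nonneg (hA0 i j) (hdo i).le) (hacc i j h)
      _ = 1 := by
          rw [← Finset.sum_div, ← hdout]
          exact div_self (hdo i).ne'
  · have h2 := (hdi j).ne'
    have h4 := hc.ne'
    calc ∑ i, π i * (A i j * π j / (c * π i * din j))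
        = ∑ i, A i j * (π j / (c * din j)) := by
          refine Finset.sum_congr rfl fun i _ => ?_
          have h3 := (hπpos i).ne'
          field_simp
      _ = (1 / c) * π j := by
          rw [← Finset.sum_mul, ← hdin]
          field_simp
end

section
/- Let V be a finite nonempty set, A a matrix on V with entries in {0,1} with out-degrees d_i^+ = ∑_j A_{ij}, S a nonempty subset of V, and suppose every j ∈ V is reachable from S, i.e., for every j ∈ V there exist s ∈ S and k ≥ 0 with (A^k)_{sj} > 0. Fix p ∈ (0,1) and define Q on V×V by Q_{ij} := (1−p)·(1/|S|)·1{j∈S} + p·(1/|S|)·1{j∈S}·1{d_i^+ = 0} + p·(A_{ij}/d_i^+)·1{d_i^+ > 0}. Then Q is row-stochastic, and Q is irreducible: for every i, j ∈ V there exists m ≥ 1 with (Q^m)_{ij} > 0. -/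
open scoped Classical

/-- The personalized-PageRank-type proposal chain on a (not necessarily
strongly connected) directed graph, restarting uniformly in a nonempty set `S` from
which every node is reachable, is row-stochastic and irreducible. -/
theorem ppr_proposal_irreducible
    {V : Type*} [Fintype V] [Nonempty V] [DecidableEq V]
    (A : Matrix V V ℝ)
    (hA01 : ∀ i j, A i j = 0 ∨ A i j = 1)
    (dout : V → ℝ)
    (hdout : ∀ i, dout i = ∑ j, A i j)
    (S : Finset V) (hS : S.Nonempty)
    (hreach : ∀ j : V, ∃ s ∈ S, ∃ k : ℕ, 0 < (A ^ k) s j)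
    (p : ℝ) (hp0 : 0 < p) (hp1 : p < 1)
    (Q : Matrix V V ℝ)
    (hQ : ∀ i j, Q i j =
      (1 - p) * (1 / (S.card : ℝ)) * (if j ∈ S then 1 else 0)
      + p * (1 / (S.card : ℝ)) * (if j ∈ S then 1 else 0)
          * (if dout i = 0 then 1 else 0)
      + p * (A i j / dout i) * (if 0 < dout i then 1 else 0)) :
    (∀ i j, 0 ≤ Q i j) ∧
    (∀ i, ∑ j, Q i j = 1) ∧
    (∀ i j, ∃ m ≥ 1, 0 < (Q ^ m) i j) := by
  have hA0 : ∀ i j, 0 ≤ A i j := fun i j => by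
    rcases hA01 i j with h | h <;> rw [h] <;> norm_num
  have hd0 : ∀ i, 0 ≤ dout i := fun i => by
    rw [hdout]; exact Finset.sum_nonneg fun j _ => hA0 i j
  have hc : (0 : ℝ) < S.card := by exact_mod_cast hS.card_pos
  have h1p : 0 < 1 - p := by linarith
  have t1 : ∀ j, 0 ≤ (1 - p) * (1 / (S.card : ℝ)) * (if j ∈ S then (1 : ℝ) else 0) := fun j => by
    split_ifs <;> positivity
  have t2 : ∀ i j, 0 ≤ p * (1 / (S.card : ℝ)) * (if j ∈ S then (1 : ℝ) else 0)
          * (if dout i = 0 then 1 else 0) := fun i j => by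
    split_ifs <;> positivity
  have t3 : ∀ i j, 0 ≤ p * (A i j / dout i) * (if 0 < dout i then (1 : ℝ) else 0) := fun i j => by
    have := div_nonneg (hA0 i j) (hd0 i)
    split_ifs <;> positivity
  have hQ0 : ∀ i j, 0 ≤ Q i j := fun i j => by
    rw [hQ]; linarith [t1 j, t2 i j, t3 i j]
  have pw : ∀ (M : Matrix V V ℝ), (∀ i j, 0 ≤ M i j) → ∀ (k : ℕ) i j, 0 ≤ (M ^ k) i j := by
    intro M hM k
    induction k with
    | zero => intro i j; rw [pow_zero, Matrix.one_apply]; split_ifs <;> norm_num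
    | succ k ih =>
      intro i j
      rw [pow_succ, Matrix.mul_apply]
      exact Finset.sum_nonneg fun l _ => mul_nonneg (ih i l) (hM l j)
  have hQS : ∀ i j, j ∈ S → 0 < Q i j := fun i j hj => by
    have h : 0 < (1 - p) * (1 / (S.card : ℝ)) * (if j ∈ S then (1 : ℝ) else 0) := by
      rw [if_pos hj]; positivity
    rw [hQ]; linarith [t2 i j, t3 i j]
  have hQA : ∀ i j, 0 < A i j → 0 < Q i j := fun i j hj => by
    have hd : 0 < dout i := by
      rw [hdout]
      exact Finset.sum_pos' (fun l _ => hA0 i l) ⟨j, Finset.mem_univ _, hj⟩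
    have h : 0 < p * (A i j / dout i) * (if 0 < dout i then (1 : ℝ) else 0) := by
      rw [if_pos hd]; positivity
    rw [hQ]; linarith [t1 j, t2 i j]
  have key : ∀ (k : ℕ) s j, 0 < (A ^ k) s j → 0 < (Q ^ k) s j := by
    intro k
    induction k with
    | zero => intro s j h; simpa using h
    | succ k ih =>
      intro s j h
      rw [pow_succ, Matrix.mul_apply] at h ⊢
      obtain ⟨l, hl, hl'⟩ := Finset.exists_lt_of_sum_lt (s := Finset.univ) (f := fun _ : V => (0 : ℝ))
        (by simpa using h)
      have ha : 0 < (A ^ k) s l := lt_of_le_of_ne (pw A hA0 k s l) (by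
        intro e; rw [← e] at hl'; simp at hl')
      have hb : 0 < A l j := lt_of_le_of_ne (hA0 l j) (by
        intro e; rw [← e] at hl'; simp at hl')
      exact Finset.sum_pos' (fun l _ => mul_nonneg (pw Q hQ0 k s l) (hQ0 l j))
        ⟨l, Finset.mem_univ _, mul_pos (ih s l ha) (hQA l j hb)⟩
  refine ⟨hQ0, ?_, ?_⟩
  · intro i
    have hs : ∑ j, (if j ∈ S then (1 : ℝ) else 0) = S.card := by simp
    simp_rw [hQ, Finset.sum_add_distrib, ← Finset.sum_mul, ← Finset.mul_sum, ← Finset.sum_div]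
    rw [← hdout, hs]
    rcases (hd0 i).eq_or_lt with h | h
    · rw [← h]; simp; field_simp; ring
    · rw [if_neg h.ne', if_pos h]; field_simp; ring
  · intro i j
    obtain ⟨s, hs, k, hk⟩ := hreach j
    refine ⟨k + 1, by omega, ?_⟩
    rw [pow_succ', Matrix.mul_apply]
    exact Finset.sum_pos' (fun l _ => mul_nonneg (hQ0 i l) (pw Q hQ0 k l j))
      ⟨s, Finset.mem_univ _, mul_pos (hQS i s hs) (key k s j hk)⟩
end
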